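/- Let K be a field, N ≥ 1 and n ≥ 1 integers, h ∈ K, and let u₀, v₁, …, v_n ∈ K satisfy v_i ≠ v_j for all 1 ≤ i < j ≤ n and u₀ + v_k ≠ 0 for all k. Then, as operators on (K^N)^{⊗(n+1)} with tensor factors labeled 0, 1, …, n: ( ∏_{1 ≤ i < j ≤ n} R_{ij}(v_i − v_j) ) · R_{01}(u₀+v₁) R_{02}(u₀+v₂) ⋯ R_{0n}(u₀+v_n) = R_{0n}(u₀+v_n) ⋯ R_{02}(u₀+v₂) R_{01}(u₀+v₁) · ( ∏_{1 ≤ i < j ≤ n} R_{ij}(v_i − v_j) ), where the product over pairs (i,j) is taken in lexicographic order. -/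

import Mathlib

/-- The permutation operator `P` on `K^N ⊗ K^N`, `P(x ⊗ y) = y ⊗ x`,
written as a matrix with rows/columns indexed by `Fin N × Fin N`. -/
def permP (K : Type*) [Field K] (N : ℕ) : Matrix (Fin N × Fin N) (Fin N × Fin N) K :=
  fun p q => if p.1 = q.2 ∧ p.2 = q.1 then 1 else 0

/-- The Yang R-matrix `R(z) = id - (h/z) • P` on `K^N ⊗ K^N`. -/
def yangR (K : Type*) [Field K] (N : ℕ) (h z : K) :
    Matrix (Fin N × Fin N) (Fin N × Fin N) K :=
  1 - (h / z) • permP K N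

/-- The operator on `(K^N)^{⊗ m}` acting as a given two-site operator `A` on the
tensor factors `p` and `q` (with `p ≠ q`) and as the identity elsewhere. -/
def lift2 (K : Type*) [Field K] (N m : ℕ) (p q : Fin m)
    (A : Matrix (Fin N × Fin N) (Fin N × Fin N) K) :
    Matrix (Fin m → Fin N) (Fin m → Fin N) K :=
  fun x y => A (x p, x q) (y p, y q) *
    ∏ k ∈ Finset.univ.filter (fun k => k ≠ p ∧ k ≠ q), (if x k = y k then (1 : K) else 0)

/-- The list of pairs `(i,j)` with `i < j`, in lexicographic order. -/
def lexPairs (n : ℕ) : List (Fin n × Fin n) :=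
  (List.finRange n).flatMap fun i =>
    ((List.finRange n).filter fun j => i < j).map fun j => (i, j)

/-- The operator on `(K^N)^{⊗ m}` permuting the tensor factors by `σ`. -/
def permOp (K : Type*) [Field K] (N : ℕ) {m : ℕ} (σ : Equiv.Perm (Fin m)) :
    Matrix (Fin m → Fin N) (Fin m → Fin N) K :=
  fun x y => if x ∘ σ = y then 1 else 0

theorem permOp_mul (K : Type*) [Field K] (N : ℕ) {m : ℕ} (σ τ : Equiv.Perm (Fin m)) :
    permOp K N σ * permOp K N τ = permOp K N (σ * τ) := by
  ext x y
  simp only [permOp, Matrix.mul_apply, ite_mul, one_mul, zero_mul, Finset.sum_ite_eq,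
    Finset.mem_univ, if_true]
  rfl

theorem permOp_one (K : Type*) [Field K] (N m : ℕ) :
    permOp K N (1 : Equiv.Perm (Fin m)) = 1 := by
  ext x y
  simp [permOp, Matrix.one_apply]

theorem lift2_one (K : Type*) [Field K] (N : ℕ) {m : ℕ} (p q : Fin m) :
    lift2 K N m p q 1 = 1 := by
  ext x y
  simp only [lift2, Matrix.one_apply, Finset.prod_ite_zero, Finset.prod_const_one,
    Finset.mem_filter, Finset.mem_univ, true_and, Prod.mk.injEq, ← ite_and, ite_mul, one_mul,
    zero_mul]
  refine if_congr ?_ rfl rfl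
  rw [funext_iff]
  grind

theorem lift2_permP (K : Type*) [Field K] (N : ℕ) {m : ℕ} {p q : Fin m} (hpq : p ≠ q) :
    lift2 K N m p q (permP K N) = permOp K N (Equiv.swap p q) := by
  ext x y
  simp only [lift2, permP, permOp, Finset.prod_ite_zero, Finset.prod_const_one,
    Finset.mem_filter, Finset.mem_univ, true_and, ← ite_and, ite_mul, one_mul, zero_mul]
  refine if_congr ?_ rfl rfl
  simp only [funext_iff, Function.comp_apply, Equiv.swap_apply_def]
  constructor
  · grind
  · intro H
    have hp := H p
    have hq := H q
    grind

theorem lift2_yangR (K : Type*) [Field K] (N : ℕ) {m : ℕ} {p q : Fin m} (hpq : p ≠ q) (h z : K) :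
    lift2 K N m p q (yangR K N h z) = 1 - (h / z) • permOp K N (Equiv.swap p q) := by
  rw [← lift2_permP K N hpq, ← lift2_one K N p q]
  ext x y
  simp only [lift2, yangR, Matrix.sub_apply, Matrix.smul_apply, smul_eq_mul]
  ring

theorem lift2_yangR_commute (K : Type*) [Field K] (N : ℕ) {m : ℕ} {p q r s : Fin m}
    (hpq : p ≠ q) (hrs : r ≠ s) (hpr : p ≠ r) (hps : p ≠ s) (hqr : q ≠ r) (hqs : q ≠ s)
    (h z w : K) :
    Commute (lift2 K N m p q (yangR K N h z)) (lift2 K N m r s (yangR K N h w)) := by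
  rw [lift2_yangR K N hpq, lift2_yangR K N hrs]
  have hswap : Equiv.swap p q * Equiv.swap r s = Equiv.swap r s * Equiv.swap p q := by
    ext k
    simp only [Equiv.Perm.mul_apply, Equiv.swap_apply_def]
    grind
  have hcomm : Commute (permOp K N (Equiv.swap p q)) (permOp K N (Equiv.swap r s)) := by
    rw [Commute, SemiconjBy, permOp_mul, permOp_mul, hswap]
  exact (Commute.one_left _).sub_left
    (((Commute.one_right _).sub_right (hcomm.smul_right _)).smul_left _)

/-- The Yang–Baxter equation for the Yang R-matrix. -/
theorem lift2_yangR_yang_baxter (K : Type*) [Field K] (N : ℕ) {m : ℕ} {o p q : Fin m}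
    (hop : o ≠ p) (hoq : o ≠ q) (hpq : p ≠ q) (h u a b : K)
    (hab : a ≠ b) (ha : u + a ≠ 0) (hb : u + b ≠ 0) :
    lift2 K N m p q (yangR K N h (a - b)) * lift2 K N m o p (yangR K N h (u + a)) *
        lift2 K N m o q (yangR K N h (u + b)) =
      lift2 K N m o q (yangR K N h (u + b)) * lift2 K N m o p (yangR K N h (u + a)) *
        lift2 K N m p q (yangR K N h (a - b)) := by
  rw [lift2_yangR K N hpq, lift2_yangR K N hop, lift2_yangR K N hoq]
  have hc : h / (a - b) * (h / (u + b)) =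
      h / (a - b) * (h / (u + a)) + h / (u + a) * (h / (u + b)) := by
    have := sub_ne_zero.mpr hab
    field_simp
    ring
  have swap_conj : ∀ {i j k : Fin m}, i ≠ j → i ≠ k → j ≠ k →
      Equiv.swap i j * Equiv.swap i k = Equiv.swap j k * Equiv.swap i j := by
    intro i j k hij hik hjk
    ext t
    simp only [Equiv.Perm.mul_apply, Equiv.swap_apply_def]
    grind
  have e₁ := swap_conj hop hoq hpq
  have e₂ := swap_conj hoq hop hpq.symm
  have e₃ := swap_conj hop.symm hpq hoq
  have e₄ := swap_conj hpq hop.symm hoq.symm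
  rw [Equiv.swap_comm q p] at e₂
  rw [Equiv.swap_comm p o] at e₃ e₄
  rw [Equiv.swap_comm q o] at e₄
  have hS := permOp_mul K N (Equiv.swap p q) (Equiv.swap p q)
  rw [Equiv.swap_mul_self, permOp_one] at hS
  have hT := permOp_mul K N (Equiv.swap o q) (Equiv.swap o q)
  rw [Equiv.swap_mul_self, permOp_one] at hT
  replace e₁ := congrArg (permOp K N) e₁
  replace e₂ := congrArg (permOp K N) e₂
  replace e₃ := congrArg (permOp K N) e₃
  replace e₄ := congrArg (permOp K N) e₄
  simp only [← permOp_mul] at e₁ e₂ e₃ e₄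
  generalize permOp K N (Equiv.swap p q) = S at *
  generalize permOp K N (Equiv.swap o p) = A at *
  generalize permOp K N (Equiv.swap o q) = B at *
  generalize h / (a - b) = x at *
  generalize h / (u + a) = y at *
  generalize h / (u + b) = z at *
  have t₁ : S * A * B = A := by rw [mul_assoc, e₁, ← mul_assoc, hS, one_mul]
  have t₂ : B * A * S = A := by rw [mul_assoc, e₃, ← mul_assoc, hT, one_mul]
  have l : (1 - x • S) * (1 - y • A) * (1 - z • B) =
      1 - x • S - y • A - z • B + (x * y) • (S * A) + (x * z) • (S * B) + (y * z) • (A * B)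
        - (x * y * z) • (S * A * B) := by
    simp only [mul_sub, sub_mul, mul_one, one_mul, smul_mul_assoc, mul_smul_comm]
    module
  have r : (1 - z • B) * (1 - y • A) * (1 - x • S) =
      1 - x • S - y • A - z • B + (x * y) • (A * S) + (x * z) • (B * S) + (y * z) • (B * A)
        - (x * y * z) • (B * A * S) := by
    simp only [mul_sub, sub_mul, mul_one, one_mul, smul_mul_assoc, mul_smul_comm]
    module
  rw [l, r, t₁, t₂, hc, e₁, ← e₄, e₃, e₂]
  module

theorem row_mul_mul_reverse_prod {M ι : Type*} [Monoid M] (A : ι → M) (B : ι → ι → M) (i : ι)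
    (l : List ι) (hl : l.Nodup)
    (hyb : ∀ j ∈ l, B i j * A i * A j = A j * A i * B i j)
    (hcomm : ∀ j ∈ l, ∀ k ∈ l, j ≠ k → Commute (B i j) (A k)) :
    (l.map (B i)).prod * A i * (l.reverse.map A).prod =
      (l.reverse.map A).prod * A i * (l.map (B i)).prod := by
  induction l with
  | nil => simp
  | cons j s ih =>
    obtain ⟨hj, hs⟩ := List.nodup_cons.mp hl
    have ih := ih hs (fun k hk => hyb k (by simp [hk]))
      (fun k hk k' hk' => hcomm k (by simp [hk]) k' (by simp [hk']))
    have c₁ : Commute (B i j) (s.reverse.map A).prod := by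
      refine Commute.list_prod_right _ _ fun x hx => ?_
      obtain ⟨k, hk, rfl⟩ := List.mem_map.mp hx
      rw [List.mem_reverse] at hk
      exact hcomm j (by simp) k (by simp [hk]) (by rintro rfl; exact hj hk)
    have c₂ : Commute (s.map (B i)).prod (A j) := by
      refine Commute.list_prod_left _ _ fun x hx => ?_
      obtain ⟨k, hk, rfl⟩ := List.mem_map.mp hx
      exact hcomm k (by simp [hk]) j (by simp) (by rintro rfl; exact hj hk)
    have hyb := hyb j (by simp)
    simp only [List.map_cons, List.prod_cons, List.reverse_cons, List.map_append, List.map_nil,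
      List.prod_append, List.prod_nil, mul_one]
    generalize (s.map (B i)).prod = R at *
    generalize (s.reverse.map A).prod = P at *
    calc B i j * R * A i * (P * A j) = B i j * (R * A i * P) * A j := by simp only [mul_assoc]
      _ = (B i j * P) * A i * (R * A j) := by rw [ih]; simp only [mul_assoc]
      _ = P * (B i j * A i * A j) * R := by rw [c₁.eq, c₂.eq]; simp only [mul_assoc]
      _ = P * A j * A i * (B i j * R) := by rw [hyb]; simp only [mul_assoc]

theorem flatMap_filter_lt_cons {ι : Type*} [LinearOrder ι] {i : ι} {t : List ι}
    (ht : ∀ j ∈ t, i < j) :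
    ((i :: t).flatMap fun a => ((i :: t).filter fun b => a < b).map fun b => (a, b)) =
      (t.map fun b => (i, b)) ++
        t.flatMap fun a => (t.filter fun b => a < b).map fun b => (a, b) := by
  rw [List.flatMap_cons]
  congr 1
  · rw [List.filter_cons_of_neg (by simp), List.filter_eq_self.mpr (by simpa using ht)]
  · refine List.flatMap_congr fun a ha => ?_
    rw [List.filter_cons_of_neg (by simpa using (ht a ha).le)]

/-- If `B i j` intertwines `A i * A j` with `A j * A i` for `i < j` and commutes with the other
`A k`, then the lexicographically ordered product of the `B i j` reverses the product of the
`A k`. -/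
theorem lex_prod_mul_prod {M ι : Type*} [Monoid M] [LinearOrder ι] (A : ι → M) (B : ι → ι → M)
    (hyb : ∀ i j, i < j → B i j * A i * A j = A j * A i * B i j)
    (hcomm : ∀ i j k, i < j → i ≠ k → j ≠ k → Commute (B i j) (A k))
    (l : List ι) (hl : l.Pairwise (· < ·)) :
    ((l.flatMap fun i => (l.filter fun j => i < j).map fun j => (i, j)).map
        fun p => B p.1 p.2).prod * (l.map A).prod =
      (l.reverse.map A).prod *
        ((l.flatMap fun i => (l.filter fun j => i < j).map fun j => (i, j)).map
          fun p => B p.1 p.2).prod := by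
  induction l with
  | nil => simp
  | cons i t ih =>
    obtain ⟨hi, ht⟩ := List.pairwise_cons.mp hl
    have ih := ih ht
    have row := row_mul_mul_reverse_prod A B i t (ht.imp ne_of_lt)
      (fun j hj => hyb i j (hi j hj))
      (fun j hj k hk hjk => hcomm i j k (hi j hj) (hi k hk).ne hjk)
    have c : Commute ((t.flatMap fun a => (t.filter fun b => a < b).map fun b => (a, b)).map
        fun p => B p.1 p.2).prod (A i) := by
      refine Commute.list_prod_left _ _ fun x hx => ?_
      simp only [List.mem_map, List.mem_flatMap, List.mem_filter, decide_eq_true_eq] at hx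
      obtain ⟨_, ⟨a, ha, b, ⟨hb, hab⟩, rfl⟩, rfl⟩ := hx
      exact hcomm a b i hab (hi a ha).ne' (hi b hb).ne'
    rw [flatMap_filter_lt_cons hi]
    simp only [List.map_append, List.prod_append, List.map_cons, List.prod_cons,
      List.reverse_cons, List.map_nil, List.prod_nil, mul_one, List.map_map, Function.comp_def]
    generalize ((t.flatMap fun a => (t.filter fun b => a < b).map fun b => (a, b)).map
        fun p => B p.1 p.2).prod = L at *
    change (t.map (B i)).prod * L * (A i * (t.map A).prod) =
      (t.reverse.map A).prod * A i * ((t.map (B i)).prod * L)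
    rw [← mul_assoc, mul_assoc _ L, c.eq, ← mul_assoc, mul_assoc _ L, ih, ← mul_assoc, row,
      mul_assoc]


/-- On `(K^N)^{⊗(n+1)}` (factors labeled `0, 1, …, n`), conjugation of the chain
`R₀₁(u₀+v₁) ⋯ R₀ₙ(u₀+vₙ)` by the lexicographically ordered product
`∏_{i<j} R_{ij}(v_i − v_j)` reverses the order of the chain. -/
theorem fusion_conjugation_chain (K : Type*) [Field K] (N n : ℕ)
    (hN : 1 ≤ N) (hn : 1 ≤ n) (h u₀ : K) (v : Fin n → K)
    (hv : ∀ i j : Fin n, i < j → v i ≠ v j) (huv : ∀ k : Fin n, u₀ + v k ≠ 0) :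
    ((lexPairs n).map fun p =>
        lift2 K N (n + 1) p.1.succ p.2.succ (yangR K N h (v p.1 - v p.2))).prod *
      ((List.finRange n).map fun k =>
        lift2 K N (n + 1) 0 k.succ (yangR K N h (u₀ + v k))).prod =
    ((List.finRange n).reverse.map fun k =>
        lift2 K N (n + 1) 0 k.succ (yangR K N h (u₀ + v k))).prod *
      ((lexPairs n).map fun p =>
        lift2 K N (n + 1) p.1.succ p.2.succ (yangR K N h (v p.1 - v p.2))).prod := by
  exact lex_prod_mul_prod
    (fun k => lift2 K N (n + 1) 0 k.succ (yangR K N h (u₀ + v k)))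
    (fun i j => lift2 K N (n + 1) i.succ j.succ (yangR K N h (v i - v j)))
    (fun i j hij => lift2_yangR_yang_baxter K N (Fin.succ_ne_zero i).symm (Fin.succ_ne_zero j).symm
      (by simpa using hij.ne) h u₀ (v i) (v j) (hv i j hij) (huv i) (huv j))
    (fun i j k hij hik hjk => lift2_yangR_commute K N (by simpa using hij.ne)
      (Fin.succ_ne_zero k).symm (Fin.succ_ne_zero i) (by simpa using hik) (Fin.succ_ne_zero j)
      (by simpa using hjk) h _ _)
    (List.finRange n) (List.pairwise_lt_finRange n)
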